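/- Let σ > 0, a_e > 0, a_t ≠ 0 with a_e/σ ≥ τ*. Define the rule δ*(x) = exp(2τ*·(a_t/(|a_t|σ))·x) / (exp(2τ*·(a_t/(|a_t|σ))·x) + 1). Then δ* is minimax optimal for the one-dimensional subproblem: for every measurable rule δ : ℝ → [0,1], sup_{s∈[−1,1]} R_sub(δ,s) ≥ sup_{s∈[−1,1]} R_sub(δ*,s), and sup_{s∈[−1,1]} R_sub(δ*,s) = (a_t² σ² / a_e²) (τ*)² ρ(τ*). -/

import Mathlib

open Real MeasureTheory

/-- The standard normal density. -/
noncomputable def gaussPdf (x : ℝ) : ℝ :=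
  (Real.sqrt (2 * Real.pi))⁻¹ * Real.exp (-(x ^ 2) / 2)

/-- ρ(a) = ∫ (1/(exp(2ay)+1))² φ(y−a) dy. -/
noncomputable def ρ (a : ℝ) : ℝ :=
  ∫ y : ℝ, (1 / (Real.exp (2 * a * y) + 1)) ^ 2 * gaussPdf (y - a)

/-- Mean square regret of a rule δ in the one-dimensional subproblem with parameter
s ∈ [−1,1], data X ~ N(s·a_e, σ²), and target effect s·a_t. -/
noncomputable def Rsub (σ aE aT : ℝ) (δ : ℝ → ℝ) (s : ℝ) : ℝ :=
  (s * aT) ^ 2 *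
    ∫ x : ℝ, ((if 0 ≤ s * aT then (1 : ℝ) else 0) - δ x) ^ 2 *
      (σ⁻¹ * gaussPdf ((x - s * aE) / σ))

lemma gaussPdf_pos (x : ℝ) : 0 < gaussPdf x := by
  unfold gaussPdf
  positivity

@[fun_prop]
lemma continuous_gaussPdf : Continuous gaussPdf := by
  unfold gaussPdf
  fun_prop

lemma gaussPdf_neg (x : ℝ) : gaussPdf (-x) = gaussPdf x := by
  simp [gaussPdf]

lemma gaussPdf_eq_gaussianPDFReal : gaussPdf = ProbabilityTheory.gaussianPDFReal 0 1 := by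
  ext x
  simp [gaussPdf, ProbabilityTheory.gaussianPDFReal]

lemma integrable_gaussPdf : Integrable gaussPdf := by
  rw [gaussPdf_eq_gaussianPDFReal]
  exact ProbabilityTheory.integrable_gaussianPDFReal 0 1

lemma integral_gaussPdf : ∫ x, gaussPdf x = 1 := by
  rw [gaussPdf_eq_gaussianPDFReal]
  exact ProbabilityTheory.integral_gaussianPDFReal_eq_one 0 one_ne_zero

lemma integrable_sq_mul_gaussPdf : Integrable fun x : ℝ => x ^ 2 * gaussPdf x := by
  have h := (integrable_rpow_mul_exp_neg_mul_sq (b := 1 / 2) (by norm_num) (s := 2)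
    (by norm_num)).const_mul (Real.sqrt (2 * Real.pi))⁻¹
  refine h.congr (Filter.Eventually.of_forall fun x => ?_)
  have e : -(x ^ 2) / 2 = -(1 / 2) * x ^ 2 := by ring
  simp only [gaussPdf, Real.rpow_two, e]
  ring

/-- Functions of at most quadratic growth are integrable against a shifted Gaussian density. -/
lemma integrable_mul_gaussPdf_sub {k : ℝ → ℝ} (hk : Measurable k) (C m : ℝ)
    (hC : ∀ y, |k y| ≤ C * (1 + y ^ 2)) : Integrable fun y => k y * gaussPdf (y - m) := by
  have hC0 : 0 ≤ C := by
    have := (abs_nonneg _).trans (hC 0)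
    simpa using this
  have h0 : Integrable fun y : ℝ => C * ((1 + 2 * m ^ 2) * gaussPdf y + 2 * (y ^ 2 * gaussPdf y)) :=
    ((integrable_gaussPdf.const_mul _).add (integrable_sq_mul_gaussPdf.const_mul _)).const_mul _
  refine (h0.comp_sub_right m).mono'
    ((hk.mul (continuous_gaussPdf.measurable.comp (measurable_id.sub_const m))).aestronglyMeasurable)
    (Filter.Eventually.of_forall fun y => ?_)
  have hp := gaussPdf_pos (y - m)
  rw [Real.norm_eq_abs, abs_mul, abs_of_pos hp]
  have h1 : 1 + y ^ 2 ≤ 1 + 2 * m ^ 2 + 2 * (y - m) ^ 2 := by nlinarith [sq_nonneg (y - 2 * m)]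
  calc |k y| * gaussPdf (y - m)
      ≤ C * (1 + 2 * m ^ 2 + 2 * (y - m) ^ 2) * gaussPdf (y - m) := by
        gcongr
        exact (hC y).trans (by gcongr)
    _ = _ := by ring

lemma integrable_bounded_mul_gaussPdf_sub {k : ℝ → ℝ} (hk : Measurable k) (C m : ℝ)
    (hC : ∀ y, |k y| ≤ C) : Integrable fun y => k y * gaussPdf (y - m) := by
  refine integrable_mul_gaussPdf_sub hk C m fun y => (hC y).trans ?_
  have : 0 ≤ C := (abs_nonneg _).trans (hC 0)
  nlinarith [mul_nonneg this (sq_nonneg y)]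

lemma hasDerivAt_gaussPdf_sub (m y : ℝ) :
    HasDerivAt (fun y => gaussPdf (y - m)) (-((y - m) * gaussPdf (y - m))) y := by
  have h1 : HasDerivAt (fun y : ℝ => -((y - m) ^ 2) / 2) (-(y - m)) y := by
    have := ((((hasDerivAt_id y).sub_const m).pow 2).neg).div_const 2
    refine this.congr_deriv ?_
    simp
    ring
  refine (h1.exp.const_mul (Real.sqrt (2 * Real.pi))⁻¹).congr_deriv ?_
  simp only [gaussPdf]
  ring

lemma gaussPdf_sub_eq (y t m : ℝ) :
    gaussPdf (y - m) =
      Real.exp ((t ^ 2 - m ^ 2) / 2) * Real.exp ((m - t) * y) * gaussPdf (y - t) := by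
  simp only [gaussPdf]
  rw [mul_left_comm, ← Real.exp_add, ← Real.exp_add]
  congr 2
  ring

/-- The decreasing logistic function. -/
noncomputable def negLogistic (x : ℝ) : ℝ := 1 / (Real.exp x + 1)

lemma negLogistic_pos (x : ℝ) : 0 < negLogistic x := by
  unfold negLogistic
  positivity

lemma negLogistic_lt_one (x : ℝ) : negLogistic x < 1 := by
  unfold negLogistic
  rw [div_lt_one (by positivity)]
  linarith [Real.exp_pos x]

lemma one_sub_negLogistic (x : ℝ) : 1 - negLogistic x = Real.exp x / (Real.exp x + 1) := by
  unfold negLogistic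
  have := Real.exp_pos x
  field_simp
  ring

lemma negLogistic_neg (x : ℝ) : negLogistic (-x) = 1 - negLogistic x := by
  rw [one_sub_negLogistic, negLogistic, Real.exp_neg]
  have := Real.exp_pos x
  field_simp
  ring

lemma antitone_negLogistic : Antitone negLogistic := by
  intro x y h
  unfold negLogistic
  gcongr

lemma hasDerivAt_negLogistic (x : ℝ) :
    HasDerivAt negLogistic (-(negLogistic x * (1 - negLogistic x))) x := by
  have hp := Real.exp_pos x
  have h := (((Real.hasDerivAt_exp x).add_const 1).inv (by positivity))
  have e : negLogistic = fun x => (Real.exp x + 1)⁻¹ := by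
    ext x
    simp [negLogistic]
  rw [one_sub_negLogistic]
  nth_rw 1 [e]
  refine h.congr_deriv ?_
  rw [negLogistic]
  field_simp

@[fun_prop]
lemma continuous_negLogistic : Continuous negLogistic :=
  continuous_iff_continuousAt.2 fun x => (hasDerivAt_negLogistic x).continuousAt

lemma abs_negLogistic_sub_le (x y : ℝ) : |negLogistic x - negLogistic y| ≤ |x - y| := by
  have h := lipschitzWith_of_nnnorm_deriv_le (f := negLogistic) (C := 1)
    (fun x => (hasDerivAt_negLogistic x).differentiableAt) (fun x => by
      rw [(hasDerivAt_negLogistic x).deriv, ← NNReal.coe_le_coe, coe_nnnorm, Real.norm_eq_abs,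
        abs_neg, NNReal.coe_one]
      have h1 := negLogistic_pos x
      have h2 := negLogistic_lt_one x
      rw [abs_of_pos (mul_pos h1 (by linarith))]
      nlinarith)
  simpa [Real.dist_eq] using h.dist_le_mul x y

/-- The squared error probability `E[negLogistic (2tY) ^ 2]` for `Y ~ N(m, 1)`. -/
noncomputable def logisticLoss (t m : ℝ) : ℝ :=
  ∫ y : ℝ, negLogistic (2 * t * y) ^ 2 * gaussPdf (y - m)

lemma ρ_eq_logisticLoss (a : ℝ) : ρ a = logisticLoss a a := rfl

/-- The derivative of `y ↦ negLogistic (2 * t * y) ^ 2`. -/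
noncomputable def sqDeriv (t y : ℝ) : ℝ :=
  -(4 * t) * (negLogistic (2 * t * y) ^ 2 * (1 - negLogistic (2 * t * y)))

/-- The second derivative of `y ↦ negLogistic (2 * t * y) ^ 2`. -/
noncomputable def sqDeriv₂ (t y : ℝ) : ℝ :=
  8 * t ^ 2 * (negLogistic (2 * t * y) ^ 2 * (1 - negLogistic (2 * t * y)) *
    (2 - 3 * negLogistic (2 * t * y)))

/-- The integrand of the derivative of the scaled loss divided by `m`. -/
noncomputable def scoreKernel (t y : ℝ) : ℝ :=
  2 * negLogistic (2 * t * y) ^ 2 + y * sqDeriv t y - sqDeriv₂ t y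

@[fun_prop]
lemma continuous_sqDeriv (t : ℝ) : Continuous (sqDeriv t) := by
  unfold sqDeriv
  fun_prop

@[fun_prop]
lemma continuous_sqDeriv₂ (t : ℝ) : Continuous (sqDeriv₂ t) := by
  unfold sqDeriv₂
  fun_prop

lemma hasDerivAt_negLogistic_comp (t y : ℝ) :
    HasDerivAt (fun y => negLogistic (2 * t * y))
      (-(negLogistic (2 * t * y) * (1 - negLogistic (2 * t * y))) * (2 * t)) y := by
  have h := (hasDerivAt_negLogistic (2 * t * y)).comp y ((hasDerivAt_id y).const_mul (2 * t))
  simpa [Function.comp_def] using h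

lemma hasDerivAt_negLogistic_sq (t y : ℝ) :
    HasDerivAt (fun y => negLogistic (2 * t * y) ^ 2) (sqDeriv t y) y := by
  refine ((hasDerivAt_negLogistic_comp t y).pow 2).congr_deriv ?_
  simp only [sqDeriv]
  ring

lemma hasDerivAt_sqDeriv (t y : ℝ) : HasDerivAt (sqDeriv t) (sqDeriv₂ t y) y := by
  have h := hasDerivAt_negLogistic_comp t y
  refine (((h.pow 2).mul (h.const_sub 1)).const_mul (-(4 * t))).congr_deriv ?_
  simp only [sqDeriv₂, Pi.pow_apply]
  ring

lemma abs_negLogistic_sq_le (x : ℝ) : |negLogistic x ^ 2| ≤ 1 := by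
  have h1 := negLogistic_pos x
  have h2 := negLogistic_lt_one x
  rw [abs_of_nonneg (by positivity)]
  exact pow_le_one₀ h1.le h2.le

lemma abs_sqDeriv_le (t y : ℝ) : |sqDeriv t y| ≤ 4 * |t| := by
  have h1 := negLogistic_pos (2 * t * y)
  have h2 := negLogistic_lt_one (2 * t * y)
  rw [sqDeriv, abs_mul, abs_neg, abs_mul, abs_of_pos (by norm_num : (0 : ℝ) < 4),
    abs_of_pos (mul_pos (pow_pos h1 2) (by linarith))]
  refine mul_le_of_le_one_right (by positivity) (mul_le_one₀ (pow_le_one₀ h1.le h2.le) ?_ ?_) <;>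
    linarith

lemma abs_sqDeriv₂_le (t y : ℝ) : |sqDeriv₂ t y| ≤ 16 * t ^ 2 := by
  have h1 := negLogistic_pos (2 * t * y)
  have h2 := negLogistic_lt_one (2 * t * y)
  set u := negLogistic (2 * t * y)
  have h3 : |2 - 3 * u| ≤ 2 := by
    rw [abs_le]
    constructor <;> linarith
  have h4 : 0 < u ^ 2 * (1 - u) := mul_pos (pow_pos h1 2) (by linarith)
  have h5 : u ^ 2 * (1 - u) ≤ 1 :=
    mul_le_one₀ (pow_le_one₀ h1.le h2.le) (by linarith) (by linarith)
  change |8 * t ^ 2 * (u ^ 2 * (1 - u) * (2 - 3 * u))| ≤ _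
  rw [abs_mul, abs_of_nonneg (by positivity : 0 ≤ 8 * t ^ 2), abs_mul, abs_of_pos h4]
  have h6 : u ^ 2 * (1 - u) * |2 - 3 * u| ≤ 1 * 2 :=
    mul_le_mul h5 h3 (abs_nonneg _) zero_le_one
  nlinarith [sq_nonneg t]

lemma integrable_negLogistic_sq_mul (t m : ℝ) :
    Integrable fun y => negLogistic (2 * t * y) ^ 2 * gaussPdf (y - m) :=
  integrable_bounded_mul_gaussPdf_sub
    (by fun_prop : Continuous fun y => negLogistic (2 * t * y) ^ 2).measurable 1 m
    fun _ => abs_negLogistic_sq_le _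

lemma integrable_sqDeriv_mul (t m : ℝ) :
    Integrable fun y => sqDeriv t y * gaussPdf (y - m) :=
  integrable_bounded_mul_gaussPdf_sub (continuous_sqDeriv t).measurable _ m (abs_sqDeriv_le t)

lemma integrable_sqDeriv₂_mul (t m : ℝ) :
    Integrable fun y => sqDeriv₂ t y * gaussPdf (y - m) :=
  integrable_bounded_mul_gaussPdf_sub (continuous_sqDeriv₂ t).measurable _ m (abs_sqDeriv₂_le t)

lemma integrable_mul_sqDeriv_mul (t m : ℝ) :
    Integrable fun y => y * sqDeriv t y * gaussPdf (y - m) := by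
  refine integrable_mul_gaussPdf_sub (by fun_prop : Continuous fun y => y * sqDeriv t y).measurable
    (4 * |t|) m fun y => ?_
  rw [abs_mul, mul_comm]
  refine mul_le_mul (abs_sqDeriv_le t y) ?_ (abs_nonneg _) (by positivity)
  nlinarith [sq_nonneg (|y| - 1), sq_abs y]

lemma integrable_scoreKernel_mul (t m : ℝ) :
    Integrable fun y => scoreKernel t y * gaussPdf (y - m) := by
  refine ((((integrable_negLogistic_sq_mul t m).const_mul 2).add
    (integrable_mul_sqDeriv_mul t m)).sub (integrable_sqDeriv₂_mul t m)).congr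
    (Filter.Eventually.of_forall fun y => ?_)
  simp only [scoreKernel, Pi.add_apply, Pi.sub_apply]
  ring

lemma hasDerivAt_logisticLoss (t m : ℝ) :
    HasDerivAt (logisticLoss t) (∫ y, sqDeriv t y * gaussPdf (y - m)) m := by
  have e : logisticLoss t = fun m => ∫ y, negLogistic (2 * t * (y + m)) ^ 2 * gaussPdf y := by
    ext m
    rw [logisticLoss, ← integral_add_right_eq_self _ m]
    simp
  have e' : ∫ y, sqDeriv t y * gaussPdf (y - m) = ∫ y, sqDeriv t (y + m) * gaussPdf y := by
    rw [← integral_add_right_eq_self _ m]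
    simp
  rw [e, e']
  refine (hasDerivAt_integral_of_dominated_loc_of_deriv_le (s := Set.univ)
    (F' := fun m y => sqDeriv t (y + m) * gaussPdf y) (bound := fun y => 4 * |t| * gaussPdf y)
    Filter.univ_mem ?_ ?_ ?_ ?_ ?_ ?_).2
  · exact Filter.Eventually.of_forall fun x =>
      (by fun_prop : Continuous fun y => negLogistic (2 * t * (y + x)) ^ 2 * gaussPdf y)
        |>.aestronglyMeasurable
  · simpa using (integrable_negLogistic_sq_mul t m).comp_add_right m
  · exact (by fun_prop : Continuous fun y => sqDeriv t (y + m) * gaussPdf y).aestronglyMeasurable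
  · refine Filter.Eventually.of_forall fun y x _ => ?_
    rw [Real.norm_eq_abs, abs_mul, abs_of_pos (gaussPdf_pos y)]
    exact mul_le_mul_of_nonneg_right (abs_sqDeriv_le _ _) (gaussPdf_pos y).le
  · exact integrable_gaussPdf.const_mul _
  · refine Filter.Eventually.of_forall fun y x _ => ?_
    have h := (hasDerivAt_negLogistic_sq t (y + x)).comp_const_add y x
    exact h.mul_const _

/-- Stein's identity for the derivative of the squared logistic function. -/
lemma mul_integral_sqDeriv (t m : ℝ) :
    m * ∫ y, sqDeriv t y * gaussPdf (y - m) =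
      (∫ y, y * sqDeriv t y * gaussPdf (y - m)) - ∫ y, sqDeriv₂ t y * gaussPdf (y - m) := by
  have h0 : Integrable fun y => sqDeriv t y * -((y - m) * gaussPdf (y - m)) := by
    refine (((integrable_sqDeriv_mul t m).const_mul m).sub (integrable_mul_sqDeriv_mul t m)).congr
      (Filter.Eventually.of_forall fun y => ?_)
    simp only [Pi.sub_apply]
    ring
  have h := integral_mul_deriv_eq_deriv_mul_of_integrable
    (fun y _ => hasDerivAt_sqDeriv t y) (fun y _ => hasDerivAt_gaussPdf_sub m y)
    h0 (integrable_sqDeriv₂_mul t m) (integrable_sqDeriv_mul t m)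
  have h' : ∫ y, sqDeriv t y * -((y - m) * gaussPdf (y - m)) =
      m * (∫ y, sqDeriv t y * gaussPdf (y - m)) - ∫ y, y * sqDeriv t y * gaussPdf (y - m) := by
    rw [← integral_const_mul, ← integral_sub ((integrable_sqDeriv_mul t m).const_mul m)
      (integrable_mul_sqDeriv_mul t m)]
    congr 1 with y
    ring
  linarith

lemma hasDerivAt_sq_mul_logisticLoss (t m : ℝ) :
    HasDerivAt (fun m => m ^ 2 * logisticLoss t m)
      (m * ∫ y, scoreKernel t y * gaussPdf (y - m)) m := by
  refine ((hasDerivAt_pow 2 m).mul (hasDerivAt_logisticLoss t m)).congr_deriv ?_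
  have h : ∫ y, scoreKernel t y * gaussPdf (y - m) = 2 * logisticLoss t m +
      (∫ y, y * sqDeriv t y * gaussPdf (y - m)) - ∫ y, sqDeriv₂ t y * gaussPdf (y - m) := by
    have h1 := (integrable_negLogistic_sq_mul t m).const_mul 2
    have h2 := integrable_mul_sqDeriv_mul t m
    have h3 : Integrable fun y => 2 * (negLogistic (2 * t * y) ^ 2 * gaussPdf (y - m)) +
        y * sqDeriv t y * gaussPdf (y - m) := h1.add h2
    rw [logisticLoss, ← integral_const_mul, ← integral_add h1 h2,
      ← integral_sub h3 (integrable_sqDeriv₂_mul t m)]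
    congr 1 with y
    simp only [scoreKernel]
    ring
  have h' := mul_integral_sqDeriv t m
  rw [h, add_sub_assoc, ← h']
  push_cast
  ring

lemma exists_sign_change_scoreKernel {t : ℝ} (ht : 0 < t) :
    ∃ y₀, (∀ y ≤ y₀, 0 ≤ scoreKernel t y) ∧ ∀ y, y₀ ≤ y → scoreKernel t y ≤ 0 := by
  let p : ℝ → ℝ := fun y => 2 + 2 * Real.exp (-(2 * t * y)) - 4 * t * y - 16 * t ^ 2 +
    24 * t ^ 2 * negLogistic (2 * t * y)
  have hp : Continuous p := by
    unfold p
    fun_prop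
  have hanti : Antitone p := by
    intro x y hxy
    have h1 : 2 * t * x ≤ 2 * t * y := by gcongr
    have h2 := antitone_negLogistic h1
    have h3 : Real.exp (-(2 * t * y)) ≤ Real.exp (-(2 * t * x)) := by gcongr
    have h4 := mul_le_mul_of_nonneg_left h2 (by positivity : 0 ≤ 24 * t ^ 2)
    simp only [p]
    linarith
  have key : ∀ y, scoreKernel t y =
      negLogistic (2 * t * y) ^ 2 * (1 - negLogistic (2 * t * y)) * p y := by
    intro y
    have e : (1 - negLogistic (2 * t * y)) * (1 + Real.exp (-(2 * t * y))) = 1 := by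
      rw [one_sub_negLogistic, Real.exp_neg]
      have := Real.exp_pos (2 * t * y)
      field_simp
    simp only [scoreKernel, sqDeriv, sqDeriv₂, p]
    linear_combination (-2 * negLogistic (2 * t * y) ^ 2) * e
  have hpos : ∀ y, 0 < negLogistic (2 * t * y) ^ 2 * (1 - negLogistic (2 * t * y)) := fun y =>
    mul_pos (pow_pos (negLogistic_pos _) 2) (by linarith [negLogistic_lt_one (2 * t * y)])
  have hl : 0 ≤ p (-(4 * t)) := by
    have h1 := negLogistic_pos (2 * t * -(4 * t))
    have h2 := Real.exp_pos (-(2 * t * -(4 * t)))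
    have h3 : 0 ≤ 24 * t ^ 2 * negLogistic (2 * t * -(4 * t)) := by positivity
    simp only [p]
    nlinarith
  have hr : p (2 * t + t⁻¹) ≤ 0 := by
    have h1 := negLogistic_lt_one (2 * t * (2 * t + t⁻¹))
    have h2 : Real.exp (-(2 * t * (2 * t + t⁻¹))) ≤ 1 := by
      rw [Real.exp_le_one_iff, neg_nonpos]
      positivity
    have h3 : t * (2 * t + t⁻¹) = 2 * t ^ 2 + 1 := by field_simp
    have h4 := mul_le_mul_of_nonneg_left h1.le (by positivity : 0 ≤ 24 * t ^ 2)
    simp only [p]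
    nlinarith
  have hti : 0 < t⁻¹ := by positivity
  obtain ⟨y₀, -, hy₀⟩ := intermediate_value_Icc' (by linarith : -(4 * t) ≤ 2 * t + t⁻¹)
    hp.continuousOn ⟨hr, hl⟩
  refine ⟨y₀, fun y hy => ?_, fun y hy => ?_⟩
  · rw [key]
    exact mul_nonneg (hpos y).le (hy₀ ▸ hanti hy)
  · rw [key]
    exact mul_nonpos_of_nonneg_of_nonpos (hpos y).le (hy₀ ▸ hanti hy)

/-- Total positivity of the Gaussian shift family: a single sign change of the kernel is
inherited by its Gaussian averages. -/
lemma integral_scoreKernel_sign {t r : ℝ} (ht : 0 < t)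
    (h0 : ∫ y, scoreKernel t y * gaussPdf (y - r) = 0) (m : ℝ) :
    (m ≤ r → 0 ≤ ∫ y, scoreKernel t y * gaussPdf (y - m)) ∧
      (r ≤ m → ∫ y, scoreKernel t y * gaussPdf (y - m) ≤ 0) := by
  obtain ⟨y₀, hl, hr⟩ := exists_sign_change_scoreKernel ht
  set c := Real.exp ((r ^ 2 - m ^ 2) / 2)
  set b := c * Real.exp ((m - r) * y₀)
  have e : ∫ y, scoreKernel t y * gaussPdf (y - m) =
      ∫ y, (scoreKernel t y * gaussPdf (y - m) - b * (scoreKernel t y * gaussPdf (y - r))) := by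
    rw [integral_sub (integrable_scoreKernel_mul t m)
      ((integrable_scoreKernel_mul t r).const_mul b), integral_const_mul, h0]
    ring
  have e' : ∀ y, scoreKernel t y * gaussPdf (y - m) - b * (scoreKernel t y * gaussPdf (y - r)) =
      c * gaussPdf (y - r) *
        (scoreKernel t y * (Real.exp ((m - r) * y) - Real.exp ((m - r) * y₀))) := by
    intro y
    rw [gaussPdf_sub_eq y r m]
    ring
  have hc : ∀ y, 0 ≤ c * gaussPdf (y - r) := fun y =>
    mul_nonneg (Real.exp_pos _).le (gaussPdf_pos _).le
  rw [e]
  simp_rw [e']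
  refine ⟨fun hm => integral_nonneg fun y => mul_nonneg (hc y) ?_,
    fun hm => integral_nonpos fun y => mul_nonpos_of_nonneg_of_nonpos (hc y) ?_⟩
  · rcases le_total y y₀ with hy | hy
    · exact mul_nonneg (hl y hy) (sub_nonneg.2 (Real.exp_le_exp.2 (by nlinarith)))
    · exact mul_nonneg_of_nonpos_of_nonpos (hr y hy)
        (sub_nonpos.2 (Real.exp_le_exp.2 (by nlinarith)))
  · rcases le_total y y₀ with hy | hy
    · exact mul_nonpos_of_nonneg_of_nonpos (hl y hy)
        (sub_nonpos.2 (Real.exp_le_exp.2 (by nlinarith)))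
    · exact mul_nonpos_of_nonpos_of_nonneg (hr y hy)
        (sub_nonneg.2 (Real.exp_le_exp.2 (by nlinarith)))

lemma sq_mul_logisticLoss_le_of_critical {t : ℝ} (ht : 0 < t)
    (h0 : ∫ y, scoreKernel t y * gaussPdf (y - t) = 0) {m : ℝ} (hm : 0 ≤ m) :
    m ^ 2 * logisticLoss t m ≤ t ^ 2 * logisticLoss t t := by
  have hd : Differentiable ℝ fun m => m ^ 2 * logisticLoss t m := fun m =>
    (hasDerivAt_sq_mul_logisticLoss t m).differentiableAt
  rcases le_total m t with h | h
  · refine monotoneOn_of_deriv_nonneg (convex_Icc 0 t) hd.continuous.continuousOn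
      hd.differentiableOn (fun x hx => ?_) ⟨hm, h⟩ ⟨ht.le, le_rfl⟩ h
    rw [interior_Icc] at hx
    rw [(hasDerivAt_sq_mul_logisticLoss t x).deriv]
    exact mul_nonneg hx.1.le ((integral_scoreKernel_sign ht h0 x).1 hx.2.le)
  · refine antitoneOn_of_deriv_nonpos (convex_Ici t) hd.continuous.continuousOn
      hd.differentiableOn (fun x hx => ?_) Set.self_mem_Ici h h
    rw [interior_Ici] at hx
    rw [(hasDerivAt_sq_mul_logisticLoss t x).deriv]
    exact mul_nonpos_of_nonneg_of_nonpos (ht.trans hx).le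
      ((integral_scoreKernel_sign ht h0 x).2 (le_of_lt hx))

lemma integral_one_sub_negLogistic_sq (t m : ℝ) :
    ∫ y, (1 - negLogistic (2 * t * y)) ^ 2 * gaussPdf (y - -m) = logisticLoss t m := by
  rw [logisticLoss, ← integral_neg_eq_self]
  congr 1 with y
  rw [← negLogistic_neg, ← gaussPdf_neg]
  congr 3 <;> ring

/-- The excess of the two-point Bayes risk of a rule over the risk `2 * ρ τ` of the Bayes rule. -/
lemma bayes_risk_eq {d : ℝ → ℝ} (hd : Measurable d) (hd01 : ∀ y, d y ∈ Set.Icc (0 : ℝ) 1)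
    (τ : ℝ) :
    (∫ y, (1 - d y) ^ 2 * gaussPdf (y - τ)) + ∫ y, d y ^ 2 * gaussPdf (y - -τ) =
      2 * ρ τ + ((∫ y, (d y - (1 - negLogistic (2 * τ * y))) ^ 2 * gaussPdf (y - τ)) +
        ∫ y, (d y - (1 - negLogistic (2 * τ * y))) ^ 2 * gaussPdf (y - -τ)) := by
  have hu : Measurable fun y => negLogistic (2 * τ * y) :=
    (by fun_prop : Continuous fun y => negLogistic (2 * τ * y)).measurable
  have sq_le : ∀ x : ℝ, -1 ≤ x → x ≤ 1 → |x ^ 2| ≤ 1 := fun x h1 h2 => by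
    rw [abs_of_nonneg (sq_nonneg x)]
    nlinarith
  have i1 := integrable_bounded_mul_gaussPdf_sub ((hd.const_sub 1).pow_const 2) 1 τ fun y =>
    sq_le _ (by linarith [(hd01 y).2]) (by linarith [(hd01 y).1])
  have i2 := integrable_bounded_mul_gaussPdf_sub (hd.pow_const 2) 1 (-τ) fun y =>
    sq_le _ (by linarith [(hd01 y).1]) (hd01 y).2
  have i3 : ∀ m, Integrable fun y =>
      (d y - (1 - negLogistic (2 * τ * y))) ^ 2 * gaussPdf (y - m) := fun m =>
    integrable_bounded_mul_gaussPdf_sub ((hd.sub (hu.const_sub 1)).pow_const 2) 1 m fun y =>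
    sq_le (d y - (1 - negLogistic (2 * τ * y))) (by linarith [(hd01 y).1, negLogistic_pos (2 * τ * y)])
      (by linarith [(hd01 y).2, negLogistic_lt_one (2 * τ * y)])
  have i4 := integrable_negLogistic_sq_mul τ τ
  have i5 := integrable_bounded_mul_gaussPdf_sub ((hu.const_sub 1).pow_const 2) 1 (-τ) fun y =>
    sq_le _ (by linarith [negLogistic_lt_one (2 * τ * y)])
      (by linarith [negLogistic_pos (2 * τ * y)])
  have e : 2 * ρ τ = (∫ y, negLogistic (2 * τ * y) ^ 2 * gaussPdf (y - τ)) +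
      ∫ y, (1 - negLogistic (2 * τ * y)) ^ 2 * gaussPdf (y - -τ) := by
    rw [integral_one_sub_negLogistic_sq, ρ_eq_logisticLoss, two_mul]
    rfl
  have i6 : Integrable fun y => negLogistic (2 * τ * y) ^ 2 * gaussPdf (y - τ) +
      (1 - negLogistic (2 * τ * y)) ^ 2 * gaussPdf (y - -τ) := i4.add i5
  have i7 : Integrable fun y =>
      (d y - (1 - negLogistic (2 * τ * y))) ^ 2 * gaussPdf (y - τ) +
        (d y - (1 - negLogistic (2 * τ * y))) ^ 2 * gaussPdf (y - -τ) := (i3 τ).add (i3 (-τ))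
  rw [e, ← integral_add i1 i2, ← integral_add i4 i5, ← integral_add (i3 τ) (i3 (-τ)),
    ← integral_add i6 i7]
  congr 1 with y
  have hA : gaussPdf (y - τ) = Real.exp (2 * τ * y) * gaussPdf (y - -τ) := by
    rw [gaussPdf_sub_eq y (-τ) τ]
    simp [two_mul]
  have hB : negLogistic (2 * τ * y) * Real.exp (2 * τ * y) = 1 - negLogistic (2 * τ * y) := by
    rw [one_sub_negLogistic, negLogistic]
    ring
  simp only [hA]
  linear_combination (-2 * (d y - (1 - negLogistic (2 * τ * y))) * gaussPdf (y - -τ)) * hB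

lemma two_mul_ρ_le_bayes_risk {d : ℝ → ℝ} (hd : Measurable d)
    (hd01 : ∀ y, d y ∈ Set.Icc (0 : ℝ) 1) (τ : ℝ) :
    2 * ρ τ ≤
      (∫ y, (1 - d y) ^ 2 * gaussPdf (y - τ)) + ∫ y, d y ^ 2 * gaussPdf (y - -τ) := by
  rw [bayes_risk_eq hd hd01, le_add_iff_nonneg_right]
  exact add_nonneg
    (integral_nonneg fun y => mul_nonneg (sq_nonneg _) (gaussPdf_pos _).le)
    (integral_nonneg fun y => mul_nonneg (sq_nonneg _) (gaussPdf_pos _).le)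

lemma integral_sq_mul_gaussPdf_sub_le (m : ℝ) :
    ∫ y, y ^ 2 * gaussPdf (y - m) ≤ 2 * m ^ 2 + 2 * ∫ y, y ^ 2 * gaussPdf y := by
  have e : 2 * m ^ 2 + 2 * ∫ y, y ^ 2 * gaussPdf y =
      ∫ y, (2 * m ^ 2 * gaussPdf y + 2 * (y ^ 2 * gaussPdf y)) := by
    rw [integral_add (integrable_gaussPdf.const_mul _) (integrable_sq_mul_gaussPdf.const_mul _),
      integral_const_mul, integral_const_mul, integral_gaussPdf, mul_one]
  have h : Integrable fun y : ℝ => y ^ 2 * gaussPdf (y - m) :=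
    integrable_mul_gaussPdf_sub (by fun_prop : Continuous fun y : ℝ => y ^ 2).measurable 1 m
      fun y => by
        rw [abs_of_nonneg (sq_nonneg y)]
        linarith
  rw [e, ← integral_add_right_eq_self _ m]
  refine integral_mono (h.comp_add_right m)
    ((integrable_gaussPdf.const_mul _).add (integrable_sq_mul_gaussPdf.const_mul _)) fun y => ?_
  have hp := (gaussPdf_pos y).le
  simp only [add_sub_cancel_right]
  nlinarith [mul_nonneg (sq_nonneg (y - m)) hp]

lemma logisticLoss_le_ρ_add (t τ : ℝ) :
    logisticLoss t τ ≤
      ρ τ + 4 * (τ - t) ^ 2 * (2 * τ ^ 2 + 2 * ∫ y, y ^ 2 * gaussPdf y) := by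
  have hu : ∀ t : ℝ, Measurable fun y => negLogistic (2 * t * y) := fun t =>
    (by fun_prop : Continuous fun y => negLogistic (2 * t * y)).measurable
  have h := bayes_risk_eq ((hu t).const_sub 1) (fun y =>
    ⟨by linarith [negLogistic_lt_one (2 * t * y)], by linarith [negLogistic_pos (2 * t * y)]⟩) τ
  rw [integral_one_sub_negLogistic_sq] at h
  simp only [sub_sub_cancel] at h
  have hb : ∀ m, ∫ y, (1 - negLogistic (2 * t * y) - (1 - negLogistic (2 * τ * y))) ^ 2 *
      gaussPdf (y - m) ≤ 4 * (τ - t) ^ 2 * (2 * m ^ 2 + 2 * ∫ y, y ^ 2 * gaussPdf y) := by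
    intro m
    have hle : ∀ y : ℝ, (1 - negLogistic (2 * t * y) - (1 - negLogistic (2 * τ * y))) ^ 2 ≤
        4 * (τ - t) ^ 2 * y ^ 2 := by
      intro y
      have := sq_le_sq' (neg_le_of_abs_le (abs_negLogistic_sub_le (2 * τ * y) (2 * t * y)))
        (le_of_abs_le (abs_negLogistic_sub_le (2 * τ * y) (2 * t * y)))
      rw [sq_abs] at this
      calc _ = (negLogistic (2 * τ * y) - negLogistic (2 * t * y)) ^ 2 := by ring
        _ ≤ _ := this
        _ = _ := by ring
    have hC : 0 ≤ 4 * (τ - t) ^ 2 := by positivity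
    calc _ ≤ ∫ y, 4 * (τ - t) ^ 2 * (y ^ 2 * gaussPdf (y - m)) := by
          refine integral_mono (integrable_mul_gaussPdf_sub
            ((((hu t).const_sub 1).sub ((hu τ).const_sub 1)).pow_const 2)
            (4 * (τ - t) ^ 2) m fun y => ?_) ((integrable_mul_gaussPdf_sub
            (by fun_prop : Continuous fun y : ℝ => y ^ 2).measurable 1 m fun y => ?_).const_mul _)
            fun y => ?_
          · simp only [Pi.sub_apply]
            rw [abs_of_nonneg (sq_nonneg _)]
            exact (hle y).trans (by nlinarith)
          · rw [abs_of_nonneg (sq_nonneg y)]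
            linarith
          · simp only
            rw [← mul_assoc]
            exact mul_le_mul_of_nonneg_right (hle y) (gaussPdf_pos _).le
      _ ≤ _ := by
          rw [integral_const_mul]
          exact mul_le_mul_of_nonneg_left (integral_sq_mul_gaussPdf_sub_le m) hC
  have h1 := hb τ
  have h2 := hb (-τ)
  rw [neg_sq] at h2
  have h3 : ∫ y, negLogistic (2 * t * y) ^ 2 * gaussPdf (y - τ) = logisticLoss t τ := rfl
  rw [h3] at h
  linarith

lemma ρ_pos (a : ℝ) : 0 < ρ a := by
  have hpos : ∀ y, 0 < negLogistic (2 * a * y) ^ 2 * gaussPdf (y - a) := fun y =>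
    mul_pos (pow_pos (negLogistic_pos _) 2) (gaussPdf_pos _)
  rw [ρ_eq_logisticLoss, logisticLoss,
    integral_pos_iff_support_of_nonneg (fun y => (hpos y).le) (integrable_negLogistic_sq_mul a a),
    Function.support_eq_univ fun y => (hpos y).ne']
  simp

lemma pos_of_isMax_sq_mul_ρ {t : ℝ} (ht : 0 ≤ t)
    (hmax : ∀ τ : ℝ, 0 ≤ τ → τ ^ 2 * ρ τ ≤ t ^ 2 * ρ t) : 0 < t := by
  refine ht.lt_of_ne fun h => ?_
  have h1 := hmax 1 zero_le_one
  rw [← h] at h1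
  linarith [ρ_pos 1]

/-- If `t` maximizes `τ ^ 2 * ρ τ`, then the worst case of the logistic rule with coefficient `t`
is attained at the shift `t`. -/
lemma sq_mul_logisticLoss_le {t : ℝ} (ht : 0 ≤ t)
    (hmax : ∀ τ : ℝ, 0 ≤ τ → τ ^ 2 * ρ τ ≤ t ^ 2 * ρ t) {m : ℝ} (hm : 0 ≤ m) :
    m ^ 2 * logisticLoss t m ≤ t ^ 2 * ρ t := by
  have ht' := pos_of_isMax_sq_mul_ρ ht hmax
  refine sq_mul_logisticLoss_le_of_critical ht' ?_ hm
  set M := ∫ y, y ^ 2 * gaussPdf y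
  have hloc : IsLocalMax (fun τ => τ ^ 2 * logisticLoss t τ -
      (τ - t) ^ 2 * (4 * τ ^ 2 * (2 * τ ^ 2 + 2 * M))) t := by
    filter_upwards [lt_mem_nhds ht'] with τ hτ
    have h1 := mul_le_mul_of_nonneg_left (logisticLoss_le_ρ_add t τ) (sq_nonneg τ)
    have h2 := hmax τ hτ.le
    rw [ρ_eq_logisticLoss t] at h2
    simp only [sub_self]
    nlinarith
  have hd : HasDerivAt (fun τ => (τ - t) ^ 2 * (4 * τ ^ 2 * (2 * τ ^ 2 + 2 * M))) 0 t := by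
    have h1 : HasDerivAt (fun τ : ℝ => (τ - t) ^ 2) 0 t := by
      refine (((hasDerivAt_id t).sub_const t).pow 2).congr_deriv ?_
      simp
    have h2 : DifferentiableAt ℝ (fun τ : ℝ => 4 * τ ^ 2 * (2 * τ ^ 2 + 2 * M)) t := by fun_prop
    refine (h1.mul h2.hasDerivAt).congr_deriv ?_
    simp
  have h := hloc.hasDerivAt_eq_zero ((hasDerivAt_sq_mul_logisticLoss t t).sub hd)
  rw [sub_zero] at h
  exact (mul_eq_zero.1 h).resolve_left ht'.ne'

lemma Rsub_sign_mul {σ aE aT : ℝ} (hσ : 0 < σ) (haE : 0 < aE) (δ : ℝ → ℝ) {η : ℝ}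
    (hη : η = 1 ∨ η = -1) (k : ℝ) :
    Rsub σ aE aT δ (η * (k * σ / aE)) = aT ^ 2 * σ ^ 2 / aE ^ 2 *
      (k ^ 2 * ∫ y, ((if 0 ≤ η * (k * σ / aE) * aT then (1 : ℝ) else 0) - δ (η * σ * y)) ^ 2 *
        gaussPdf (y - k)) := by
  have hη2 : η ^ 2 = 1 := by rcases hη with rfl | rfl <;> norm_num
  have habs : |(η * σ)⁻¹| = σ⁻¹ := by
    rcases hη with rfl | rfl <;> simp [abs_of_pos hσ]
  set i : ℝ := if 0 ≤ η * (k * σ / aE) * aT then 1 else 0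
  have h := Measure.integral_comp_mul_left
    (fun x => (i - δ x) ^ 2 * (σ⁻¹ * gaussPdf ((x - η * (k * σ / aE) * aE) / σ))) (η * σ)
  rw [habs, smul_eq_mul] at h
  have h' : ∀ y, (i - δ (η * σ * y)) ^ 2 *
      (σ⁻¹ * gaussPdf ((η * σ * y - η * (k * σ / aE) * aE) / σ)) =
        σ⁻¹ * ((i - δ (η * σ * y)) ^ 2 * gaussPdf (y - k)) := by
    intro y
    have e : (η * σ * y - η * (k * σ / aE) * aE) / σ = η * (y - k) := by
      field_simp
    have e' : gaussPdf (η * (y - k)) = gaussPdf (y - k) := by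
      rcases hη with rfl | rfl
      · rw [one_mul]
      · rw [neg_one_mul, gaussPdf_neg]
    rw [e, e']
    ring
  simp_rw [h'] at h
  rw [integral_const_mul] at h
  have h'' := mul_left_cancel₀ (inv_ne_zero hσ.ne') h
  rw [Rsub, ← h'']
  have e : (η * (k * σ / aE) * aT) ^ 2 = η ^ 2 * (aT ^ 2 * σ ^ 2 / aE ^ 2 * k ^ 2) := by ring
  rw [e, hη2]
  ring

lemma Rsub_of_pos {σ aE aT : ℝ} (hσ : 0 < σ) (haE : 0 < aE) (δ : ℝ → ℝ) {ε : ℝ}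
    (hε : ε = 1 ∨ ε = -1) (hεT : 0 < ε * aT) {k : ℝ} (hk : 0 ≤ k) :
    Rsub σ aE aT δ (ε * (k * σ / aE)) = aT ^ 2 * σ ^ 2 / aE ^ 2 *
      (k ^ 2 * ∫ y, (1 - δ (ε * σ * y)) ^ 2 * gaussPdf (y - k)) := by
  have h : 0 ≤ ε * (k * σ / aE) * aT := by
    rw [mul_right_comm]
    positivity
  rw [Rsub_sign_mul hσ haE δ hε, if_pos h]

lemma Rsub_of_neg {σ aE aT : ℝ} (hσ : 0 < σ) (haE : 0 < aE) (δ : ℝ → ℝ) {ε : ℝ}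
    (hε : ε = 1 ∨ ε = -1) (hεT : 0 < ε * aT) {k : ℝ} (hk : 0 ≤ k) :
    Rsub σ aE aT δ (-ε * (k * σ / aE)) = aT ^ 2 * σ ^ 2 / aE ^ 2 *
      (k ^ 2 * ∫ y, δ (ε * σ * y) ^ 2 * gaussPdf (y - -k)) := by
  rcases hk.eq_or_lt with rfl | hk
  · simp [Rsub]
  have h : ¬ 0 ≤ -ε * (k * σ / aE) * aT := by
    rw [not_le, mul_right_comm, neg_mul, neg_mul, neg_lt_zero]
    positivity
  have hε' : -ε = 1 ∨ -ε = -1 := by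
    rcases hε with rfl | rfl <;> simp
  rw [Rsub_sign_mul hσ haE δ hε', if_neg h, ← integral_neg_eq_self]
  congr 3 with y
  rw [← gaussPdf_neg]
  have e1 : -ε * σ * -y = ε * σ * y := by ring
  have e2 : -(-y - k) = y - -k := by ring
  rw [e1, e2]
  ring

lemma integral_sq_mul_gaussPdf_le_one {d : ℝ → ℝ} (hd : Measurable d)
    (hd1 : ∀ y, |d y ^ 2| ≤ 1) (m : ℝ) : ∫ y, d y ^ 2 * gaussPdf (y - m) ≤ 1 := by
  calc ∫ y, d y ^ 2 * gaussPdf (y - m) ≤ ∫ y, gaussPdf (y - m) := by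
        refine integral_mono (integrable_bounded_mul_gaussPdf_sub (hd.pow_const 2) 1 m hd1)
          (integrable_gaussPdf.comp_sub_right m) fun y => ?_
        exact mul_le_of_le_one_left (gaussPdf_pos _).le ((le_abs_self _).trans (hd1 y))
    _ = 1 := by rw [integral_sub_right_eq_self, integral_gaussPdf]

lemma exists_eq_sign_mul {σ aE ε s : ℝ} (hσ : 0 < σ) (haE : 0 < aE) (hε : ε = 1 ∨ ε = -1)
    (hs : s ∈ Set.Icc (-1 : ℝ) 1) :
    ∃ k, 0 ≤ k ∧ k ≤ aE / σ ∧ (s = ε * (k * σ / aE) ∨ s = -ε * (k * σ / aE)) := by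
  refine ⟨|s| * aE / σ, by positivity, ?_, ?_⟩
  · have := abs_le.2 hs
    gcongr
    exact mul_le_of_le_one_left haE.le this
  · have e : |s| * aE / σ * σ / aE = |s| := by field_simp
    rw [e]
    rcases hε with rfl | rfl <;> rcases abs_choice s with h | h <;> rw [h] <;> simp

lemma bddAbove_range_Rsub {σ aE aT : ℝ} (hσ : 0 < σ) (haE : 0 < aE) {δ : ℝ → ℝ} {ε : ℝ}
    (hε : ε = 1 ∨ ε = -1) (hεT : 0 < ε * aT) (hδ : Measurable δ)
    (hδ01 : ∀ x, δ x ∈ Set.Icc (0 : ℝ) 1) :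
    BddAbove (Set.range fun s : Set.Icc (-1 : ℝ) 1 => Rsub σ aE aT δ s) := by
  refine ⟨aT ^ 2 * σ ^ 2 / aE ^ 2 * ((aE / σ) ^ 2 * 1), ?_⟩
  rintro _ ⟨⟨s, hs⟩, rfl⟩
  have hd : Measurable fun y => δ (ε * σ * y) := hδ.comp (measurable_id.const_mul _)
  obtain ⟨k, hk0, hk, rfl | rfl⟩ := exists_eq_sign_mul hσ haE hε hs
  · simp only
    rw [Rsub_of_pos hσ haE δ hε hεT hk0]
    gcongr
    · exact integral_nonneg fun y => mul_nonneg (sq_nonneg _) (gaussPdf_pos _).le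
    · refine integral_sq_mul_gaussPdf_le_one (hd.const_sub 1) (fun y => ?_) k
      have := hδ01 (ε * σ * y)
      rw [abs_of_nonneg (sq_nonneg _)]
      exact pow_le_one₀ (by linarith [this.2]) (by linarith [this.1])
  · simp only
    rw [Rsub_of_neg hσ haE δ hε hεT hk0]
    gcongr
    · exact integral_nonneg fun y => mul_nonneg (sq_nonneg _) (gaussPdf_pos _).le
    · refine integral_sq_mul_gaussPdf_le_one hd (fun y => ?_) (-k)
      have := hδ01 (ε * σ * y)
      rw [abs_of_nonneg (sq_nonneg _)]
      exact pow_le_one₀ this.1 this.2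

lemma le_iSup_Rsub {σ aE aT t : ℝ} (hσ : 0 < σ) (haE : 0 < aE) {ε : ℝ}
    (hε : ε = 1 ∨ ε = -1) (hεT : 0 < ε * aT) (ht : 0 ≤ t) (htE : t ≤ aE / σ)
    {δ : ℝ → ℝ} (hδ : Measurable δ) (hδ01 : ∀ x, δ x ∈ Set.Icc (0 : ℝ) 1) :
    aT ^ 2 * σ ^ 2 / aE ^ 2 * (t ^ 2 * ρ t) ≤ ⨆ s : Set.Icc (-1 : ℝ) 1, Rsub σ aE aT δ s := by
  have hbdd := bddAbove_range_Rsub hσ haE hε hεT hδ hδ01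
  have hs0 : 0 ≤ t * σ / aE := by positivity
  have hs1 : t * σ / aE ≤ 1 := by
    rw [div_le_one haE]
    exact (le_div_iff₀ hσ).1 htE
  have hmem : ε * (t * σ / aE) ∈ Set.Icc (-1 : ℝ) 1 ∧
      -ε * (t * σ / aE) ∈ Set.Icc (-1 : ℝ) 1 := by
    rcases hε with rfl | rfl <;> refine ⟨⟨?_, ?_⟩, ⟨?_, ?_⟩⟩ <;> linarith
  have h1 := le_ciSup hbdd ⟨_, hmem.1⟩
  have h2 := le_ciSup hbdd ⟨_, hmem.2⟩
  simp only at h1 h2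
  rw [Rsub_of_pos hσ haE δ hε hεT ht] at h1
  rw [Rsub_of_neg hσ haE δ hε hεT ht] at h2
  have hd : Measurable fun y => δ (ε * σ * y) := hδ.comp (measurable_id.const_mul _)
  have h3 := two_mul_ρ_le_bayes_risk hd (fun y => hδ01 _) t
  have h4 := mul_le_mul_of_nonneg_left h3
    (by positivity : 0 ≤ aT ^ 2 * σ ^ 2 / aE ^ 2 * t ^ 2)
  linarith

/-- For a_e/σ ≥ τ*, the logistic rule with coefficient τ* is minimax optimal for the
one-dimensional subproblem, with worst-case regret (a_t²σ²/a_e²)(τ*)²ρ(τ*). -/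
theorem stmt_4 (σ aE aT τstar : ℝ) (hσ : 0 < σ) (haE : 0 < aE) (haT : aT ≠ 0)
    (hτ0 : 0 ≤ τstar)
    (hτmax : ∀ τ : ℝ, 0 ≤ τ → τ ^ 2 * ρ τ ≤ τstar ^ 2 * ρ τstar)
    (hratio : τstar ≤ aE / σ)
    (δstar : ℝ → ℝ)
    (hδstar : ∀ x, δstar x =
      Real.exp (2 * τstar * (aT / (|aT| * σ)) * x) /
        (Real.exp (2 * τstar * (aT / (|aT| * σ)) * x) + 1)) :
    (∀ δ : ℝ → ℝ, Measurable δ → (∀ x, δ x ∈ Set.Icc (0 : ℝ) 1) →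
      (⨆ s : Set.Icc (-1 : ℝ) 1, Rsub σ aE aT δstar s) ≤
        ⨆ s : Set.Icc (-1 : ℝ) 1, Rsub σ aE aT δ s) ∧
    (⨆ s : Set.Icc (-1 : ℝ) 1, Rsub σ aE aT δstar s) =
      (aT ^ 2 * σ ^ 2 / aE ^ 2) * (τstar ^ 2 * ρ τstar) := by
  obtain ⟨ε, hε, hεT, hεeq⟩ : ∃ ε : ℝ, (ε = 1 ∨ ε = -1) ∧ 0 < ε * aT ∧ aT / (|aT| * σ) = ε / σ := by
    rcases haT.lt_or_gt with h | h
    · refine ⟨-1, Or.inr rfl, by linarith, ?_⟩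
      rw [abs_of_neg h]
      field_simp
    · refine ⟨1, Or.inl rfl, by linarith, ?_⟩
      rw [abs_of_pos h]
      field_simp
  have hstar : ∀ x, δstar x = 1 - negLogistic (2 * τstar * (ε / σ) * x) := fun x => by
    rw [hδstar, hεeq, one_sub_negLogistic]
  have hstar_scaled : ∀ y, δstar (ε * σ * y) = 1 - negLogistic (2 * τstar * y) := fun y => by
    have hε2 : ε * ε = 1 := by rcases hε with rfl | rfl <;> norm_num
    have e : 2 * τstar * (ε / σ) * (ε * σ * y) = ε * ε * (2 * τstar * y) := by
      field_simp
    rw [hstar, e, hε2, one_mul]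
  have hmeas : Measurable δstar := by
    rw [funext hstar]
    exact (by fun_prop : Continuous fun x =>
      1 - negLogistic (2 * τstar * (ε / σ) * x)).measurable
  have h01 : ∀ x, δstar x ∈ Set.Icc (0 : ℝ) 1 := fun x => by
    rw [hstar]
    exact ⟨by linarith [negLogistic_lt_one (2 * τstar * (ε / σ) * x)],
      by linarith [negLogistic_pos (2 * τstar * (ε / σ) * x)]⟩
  have hvalue : (⨆ s : Set.Icc (-1 : ℝ) 1, Rsub σ aE aT δstar s) =
      (aT ^ 2 * σ ^ 2 / aE ^ 2) * (τstar ^ 2 * ρ τstar) := by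
    have : Nonempty (Set.Icc (-1 : ℝ) 1) := ⟨⟨0, by norm_num⟩⟩
    refine le_antisymm (ciSup_le ?_) (le_iSup_Rsub hσ haE hε hεT hτ0 hratio hmeas h01)
    rintro ⟨s, hs⟩
    have hC : 0 ≤ aT ^ 2 * σ ^ 2 / aE ^ 2 := by positivity
    obtain ⟨k, hk, -, rfl | rfl⟩ := exists_eq_sign_mul hσ haE hε hs
    · simp only [Rsub_of_pos hσ haE δstar hε hεT hk, hstar_scaled, sub_sub_cancel]
      exact mul_le_mul_of_nonneg_left (sq_mul_logisticLoss_le hτ0 hτmax hk) hC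
    · simp only [Rsub_of_neg hσ haE δstar hε hεT hk, hstar_scaled,
        integral_one_sub_negLogistic_sq]
      exact mul_le_mul_of_nonneg_left (sq_mul_logisticLoss_le hτ0 hτmax hk) hC
  refine ⟨fun δ hδ hδ01 => ?_, hvalue⟩
  rw [hvalue]
  exact le_iSup_Rsub hσ haE hε hεT hτ0 hratio hδ hδ01
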